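/- Let W be a nonempty finite type, c : W → ℝ with 0 ≤ c w for all w and 0 < c w₀ for some w₀. Then for all f, g : W → ℝ, ∑_{w ∈ W} (Q_f w - P_f w) * (f w - g w) ≥ Real.log (L(f)) - Real.log (L(g)) - KL(P_f ‖ P_g). -/

import Mathlib

/-- The softmax (Gibbs) distribution associated with logits `f`. -/
noncomputable def softmax {W : Type*} [Fintype W] (f : W → ℝ) (w : W) : ℝ :=
  Real.exp (f w) / ∑ w', Real.exp (f w')

/-- The log-partition function of the logits `f`. -/
noncomputable def logPartition {W : Type*} [Fintype W] (f : W → ℝ) : ℝ :=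
  Real.log (∑ w, Real.exp (f w))

/-- Kullback–Leibler divergence between finitely supported densities `p` and `q`
(with the convention `0 * log 0 = 0`, which holds definitionally in `ℝ`). -/
noncomputable def KLdiv {W : Type*} [Fintype W] (p q : W → ℝ) : ℝ :=
  ∑ w, p w * Real.log (p w / q w)

/-- Marginal likelihood: the `c`-weighted total mass of the softmax distribution of `f`. -/
noncomputable def margL {W : Type*} [Fintype W] (c f : W → ℝ) : ℝ :=
  ∑ w, c w * softmax f w

/-- Posterior distribution obtained by reweighting the softmax distribution of `f`
by the evaluation weights `c` and normalizing. -/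
noncomputable def post {W : Type*} [Fintype W] (c f : W → ℝ) (w : W) : ℝ :=
  c w * softmax f w / margL c f

theorem softmax_pos {W : Type*} [Fintype W] [Nonempty W] (f : W → ℝ) (w : W) :
    0 < softmax f w :=
  div_pos (Real.exp_pos _) (Finset.sum_pos (fun _ _ => Real.exp_pos _) Finset.univ_nonempty)

theorem sum_softmax {W : Type*} [Fintype W] [Nonempty W] (f : W → ℝ) :
    ∑ w, softmax f w = 1 := by
  simp only [softmax]
  rw [← Finset.sum_div, div_self]
  exact (Finset.sum_pos (fun _ _ => Real.exp_pos _) Finset.univ_nonempty).ne'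

theorem log_softmax_div {W : Type*} [Fintype W] [Nonempty W] (f g : W → ℝ) (w : W) :
    Real.log (softmax f w / softmax g w) =
      f w - g w - (logPartition f - logPartition g) := by
  have sum_exp_ne (h : W → ℝ) : ∑ w, Real.exp (h w) ≠ 0 :=
    (Finset.sum_pos (fun _ _ => Real.exp_pos _) Finset.univ_nonempty).ne'
  rw [Real.log_div (softmax_pos f w).ne' (softmax_pos g w).ne', softmax, softmax,
    Real.log_div (Real.exp_pos _).ne' (sum_exp_ne f),
    Real.log_div (Real.exp_pos _).ne' (sum_exp_ne g), Real.log_exp, Real.log_exp,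
    logPartition, logPartition]
  ring

theorem margL_pos {W : Type*} [Fintype W] [Nonempty W] {c : W → ℝ} (hc : ∀ w, 0 ≤ c w)
    {w₀ : W} (hc₀ : 0 < c w₀) (f : W → ℝ) : 0 < margL c f :=
  Finset.sum_pos' (fun w _ => mul_nonneg (hc w) (softmax_pos f w).le)
    ⟨w₀, Finset.mem_univ _, mul_pos hc₀ (softmax_pos f w₀)⟩

theorem sum_post {W : Type*} [Fintype W] {c f : W → ℝ} (h : margL c f ≠ 0) :
    ∑ w, post c f w = 1 := by
  simp only [post]
  rw [← Finset.sum_div]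
  exact div_self h

/-- Gibbs' inequality for the posteriors of `f` and `g`, solved for the likelihoods. -/
theorem log_margL_sub_le {W : Type*} [Fintype W] [Nonempty W] {c : W → ℝ}
    (hc : ∀ w, 0 ≤ c w) {w₀ : W} (hc₀ : 0 < c w₀) (f g : W → ℝ) :
    Real.log (margL c f) - Real.log (margL c g) ≤
      ∑ w, post c f w * Real.log (softmax f w / softmax g w) := by
  have hf := margL_pos hc hc₀ f
  have hg := margL_pos hc hc₀ g
  have key (w : W) : post c f w * (Real.log (margL c f) - Real.log (margL c g)) +
      (post c f w - post c g w) ≤ post c f w * Real.log (softmax f w / softmax g w) := by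
    have hpf := softmax_pos f w
    have hpg := softmax_pos g w
    have hlog := Real.log_le_sub_one_of_pos
      (div_pos (mul_pos hpg hf) (mul_pos hpf hg))
    rw [Real.log_div (by positivity) (by positivity), Real.log_mul hpg.ne' hf.ne',
      Real.log_mul hpf.ne' hg.ne'] at hlog
    have hmul := mul_le_mul_of_nonneg_left hlog
      (div_nonneg (mul_nonneg (hc w) hpf.le) hf.le)
    have hpost : c w * softmax f w / margL c f *
        (softmax g w * margL c f / (softmax f w * margL c g) - 1) =
        post c g w - post c f w := by
      simp only [post]
      field_simp
    rw [hpost] at hmul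
    rw [Real.log_div hpf.ne' hpg.ne']
    change post c f w * _ ≤ _ at hmul
    linarith
  have hsum := Finset.sum_le_sum fun w (_ : w ∈ Finset.univ) => key w
  rwa [Finset.sum_add_distrib, ← Finset.sum_mul, Finset.sum_sub_distrib, sum_post hf.ne',
    sum_post hg.ne', one_mul, sub_self, add_zero] at hsum

/-- Term (II) inequality (eq:term:2): the gradient term dominates the log-likelihood
difference minus the KL divergence. -/
theorem grad_term_ge {W : Type*} [Fintype W] [Nonempty W]
    (c : W → ℝ) (hc : ∀ w, 0 ≤ c w) (w₀ : W) (hc₀ : 0 < c w₀) (f g : W → ℝ) :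
    ∑ w, (post c f w - softmax f w) * (f w - g w) ≥
      Real.log (margL c f) - Real.log (margL c g) - KLdiv (softmax f) (softmax g) := by
  have hgrad : ∑ w, (post c f w - softmax f w) * (f w - g w) =
      ∑ w, post c f w * Real.log (softmax f w / softmax g w) -
        KLdiv (softmax f) (softmax g) := by
    simp only [KLdiv, log_softmax_div, mul_sub _ (f _ - g _), Finset.sum_sub_distrib,
      ← Finset.sum_mul, sum_post (margL_pos hc hc₀ f).ne', sum_softmax, sub_mul]
    ring
  rw [hgrad]
  exact sub_le_sub_right (log_margL_sub_le hc hc₀ f g) _
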